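/- arXiv:1306.5082 — 2 statements merged into one kernel-verified Lean document; each statement's English description precedes it below -/
import Mathlib

section
/- Let P be a probability measure on (Ω, 𝓕), let Q ≪ P be another probability measure with Radon–Nikodym derivative Z = dQ/dP, and let 𝓖 ⊆ 𝓕 be a sub-σ-algebra. Then for every Q-integrable random variable Y, the equality E_Q[Y | 𝓖] · E_P[Z | 𝓖] = E_P[Z Y | 𝓖] holds P-almost surely on the event A = {E_P[Z | 𝓖] > 0}; equivalently E_Q[Y | 𝓖] = E_P[Z Y | 𝓖] / E_P[Z | 𝓖] P-a.s. on A. In particular, any two 𝓖-measurable versions of E_Q[Y | 𝓖] agree P-almost surely on A, so 1_A · E_Q[Y | 𝓖] is P-a.s. uniquely determined. -/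
open MeasureTheory Set Filter

/-- Multiplying the conditional expectation under `Q` by the conditional density gives the
conditional expectation of the density-weighted variable, `P`-almost surely everywhere. -/
theorem condExp_mul_condExp_rnDeriv
    {Ω : Type*} {m𝓕 : MeasurableSpace Ω} {P Q : Measure Ω} [IsFiniteMeasure P] [IsFiniteMeasure Q]
    (hQP : Q ≪ P) {𝓖 : MeasurableSpace Ω} (h𝓖 : 𝓖 ≤ m𝓕) {Y : Ω → ℝ} (hY : Integrable Y Q) :
    (Q[Y | 𝓖]) * (P[fun ω => (Q.rnDeriv P ω).toReal | 𝓖])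
      =ᵐ[P] P[fun ω => (Q.rnDeriv P ω).toReal * Y ω | 𝓖] := by
  have hYZ : Integrable (fun ω => (Q.rnDeriv P ω).toReal * Y ω) P :=
    (integrable_rnDeriv_smul_iff hQP).2 hY
  have hEZ : Integrable (fun ω => (Q.rnDeriv P ω).toReal * (Q[Y | 𝓖]) ω) P :=
    (integrable_rnDeriv_smul_iff hQP).2 integrable_condExp
  have hEZ' : Integrable ((Q[Y | 𝓖]) * fun ω => (Q.rnDeriv P ω).toReal) P := by
    rwa [mul_comm]
  have hpull := condExp_mul_of_stronglyMeasurable_left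
    (stronglyMeasurable_condExp (f := Y) (μ := Q) (m := 𝓖)) hEZ' Measure.integrable_toReal_rnDeriv
  refine hpull.symm.trans ?_
  refine ae_eq_condExp_of_forall_setIntegral_eq h𝓖 hYZ
    (fun s _ _ => integrable_condExp.integrableOn) (fun s hs _ => ?_)
    stronglyMeasurable_condExp.aestronglyMeasurable
  rw [setIntegral_condExp h𝓖 hEZ' hs, mul_comm]
  have h (f : Ω → ℝ) :
      ∫ ω in s, (Q.rnDeriv P ω).toReal * f ω ∂P = ∫ ω in s, f ω ∂Q :=
    setIntegral_rnDeriv_smul hQP (h𝓖 s hs)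
  exact (h _).trans ((setIntegral_condExp h𝓖 hY hs).trans (h Y).symm)

/-- A property that holds `Q`-almost surely on a sub-σ-algebra holds `P`-almost surely where the
conditional density is positive. -/
theorem ae_of_condExp_rnDeriv_pos
    {Ω : Type*} {m𝓕 : MeasurableSpace Ω} {P Q : Measure Ω} [IsFiniteMeasure P] [IsFiniteMeasure Q]
    (hQP : Q ≪ P) {𝓖 : MeasurableSpace Ω} (h𝓖 : 𝓖 ≤ m𝓕) {p : Ω → Prop}
    (hp : MeasurableSet[𝓖] {ω | p ω}) (hpQ : ∀ᵐ ω ∂Q, p ω) :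
    ∀ᵐ ω ∂P, 0 < (P[fun ω => (Q.rnDeriv P ω).toReal | 𝓖]) ω → p ω := by
  have hnonneg : 0 ≤ᵐ[P] P[fun ω => (Q.rnDeriv P ω).toReal | 𝓖] :=
    condExp_nonneg (.of_forall fun _ => ENNReal.toReal_nonneg)
  have hzero : ∫ ω in {ω | p ω}ᶜ, (P[fun ω => (Q.rnDeriv P ω).toReal | 𝓖]) ω ∂P = 0 := by
    rw [setIntegral_condExp h𝓖 Measure.integrable_toReal_rnDeriv hp.compl,
      Measure.setIntegral_toReal_rnDeriv hQP, measureReal_def, show Q {ω | p ω}ᶜ = 0 from hpQ,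
      ENNReal.toReal_zero]
  rw [setIntegral_eq_zero_iff_of_nonneg_ae (ae_restrict_of_ae hnonneg)
    integrable_condExp.integrableOn, EventuallyEq, ae_restrict_iff' (h𝓖 _ hp.compl)] at hzero
  filter_upwards [hzero] with ω hω hpos
  by_contra hn
  exact hpos.ne' (hω hn)

/-- Bayes' rule for non-equivalent probability measures: if `Q ≪ P` with density `Z = dQ/dP`
and `𝓖 ⊆ 𝓕`, then for every `Q`-integrable `Y`,
`E_Q[Y | 𝓖] · E_P[Z | 𝓖] = E_P[Z·Y | 𝓖]` holds `P`-a.s. on `{E_P[Z | 𝓖] > 0}`; in particular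
any two `𝓖`-measurable versions of `E_Q[Y | 𝓖]` agree `P`-a.s. on that event. -/
theorem bayes_rule_nonequivalent
    {Ω : Type*} {m𝓕 : MeasurableSpace Ω}
    (P Q : Measure Ω) [IsProbabilityMeasure P] [IsProbabilityMeasure Q]
    (hQP : Q ≪ P)
    (𝓖 : MeasurableSpace Ω) (h𝓖 : 𝓖 ≤ m𝓕)
    (Z : Ω → ℝ) (hZ : ∀ᵐ ω ∂P, Z ω = (Q.rnDeriv P ω).toReal)
    (Y : Ω → ℝ) (hY : Integrable Y Q) :
    (∀ᵐ ω ∂P, 0 < (P[Z | 𝓖]) ω →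
        (Q[Y | 𝓖]) ω * (P[Z | 𝓖]) ω = (P[fun ω' => Z ω' * Y ω' | 𝓖]) ω) ∧
    ∀ g₁ g₂ : Ω → ℝ, StronglyMeasurable[𝓖] g₁ → StronglyMeasurable[𝓖] g₂ →
      g₁ =ᵐ[Q] Q[Y | 𝓖] → g₂ =ᵐ[Q] Q[Y | 𝓖] →
      ∀ᵐ ω ∂P, 0 < (P[Z | 𝓖]) ω → g₁ ω = g₂ ω := by
  have hZcond : P[Z | 𝓖] =ᵐ[P] P[fun ω => (Q.rnDeriv P ω).toReal | 𝓖] := condExp_congr_ae hZ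
  have hZYcond : P[fun ω => Z ω * Y ω | 𝓖]
      =ᵐ[P] P[fun ω => (Q.rnDeriv P ω).toReal * Y ω | 𝓖] :=
    condExp_congr_ae (hZ.mono fun ω hω => by simp only [hω])
  refine ⟨?_, fun g₁ g₂ hg₁ hg₂ h₁ h₂ => ?_⟩
  · filter_upwards [condExp_mul_condExp_rnDeriv hQP h𝓖 hY, hZcond, hZYcond] with ω h hz hzy _
    rw [hz, hzy]
    exact h
  · filter_upwards [ae_of_condExp_rnDeriv_pos hQP h𝓖 (hg₁.measurableSet_eq_fun hg₂)
      (h₁.trans h₂.symm), hZcond] with ω h hz hpos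
    exact h (hz ▸ hpos)
end

section
/- Let (E, 𝓔, μ) be a measure space, ξ : E → (0,∞) measurable, and u : ℝ → ℝ differentiable, strictly increasing and strictly concave on (0,∞) with Inada conditions (u′ → ∞ at 0⁺, u′ → 0 at ∞), with inverse marginal utility I = (u′)^{-1} : (0,∞) → (0,∞). Fix y > 0 and set c* = I(y·ξ) pointwise; assume ξ·c* and u∘c* are μ-integrable and put w = ∫_E ξ·c* dμ. Then for every measurable c : E → (0,∞) with u∘c μ-integrable and ∫_E ξ·c dμ ≤ w, one has ∫_E u∘c dμ ≤ ∫_E u∘c* dμ. Moreover, if ∫_E u∘c dμ = ∫_E u∘c* dμ then c = c* μ-almost everywhere. -/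
open MeasureTheory Set Filter
open scoped ENNReal

/-- A strictly concave function lies strictly below its tangent lines away from the
point of tangency. -/
theorem StrictConcaveOn.lt_tangent_of_hasDerivAt {S : Set ℝ} {f : ℝ → ℝ} {a x f' : ℝ}
    (hf : StrictConcaveOn ℝ S f) (ha : a ∈ S) (hx : x ∈ S) (hxa : x ≠ a)
    (hd : HasDerivAt f f' a) : f x < f a + f' * (x - a) := by
  rcases lt_or_gt_of_ne hxa with h | h
  · have hs := hf.lt_slope_of_hasDerivAt hx ha h hd
    rw [slope_def_field, lt_div_iff₀ (sub_pos.2 h)] at hs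
    linarith
  · have hs := hf.slope_lt_of_hasDerivAt ha hx h hd
    rw [slope_def_field, div_lt_iff₀ (sub_pos.2 h)] at hs
    linarith

/-- Abstract utility maximization under a budget constraint: the first-order-condition
plan `c* = I(y·ξ)` maximizes `∫ u∘c dμ` over all positive measurable plans `c` satisfying
the budget constraint `∫ ξ·c dμ ≤ w = ∫ ξ·c* dμ`, and it is the unique maximizer up to
`μ`-a.e. equality. -/
theorem utility_maximization_first_order_condition
    {E : Type*} [MeasurableSpace E] (μ : Measure E)
    (ξ : E → ℝ) (hξm : Measurable ξ) (hξpos : ∀ e, 0 < ξ e)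
    (u : ℝ → ℝ)
    (hdiff : ∀ x : ℝ, 0 < x → DifferentiableAt ℝ u x)
    (hmono : StrictMonoOn u (Ioi 0))
    (hconc : StrictConcaveOn ℝ (Ioi 0) u)
    (hinada_zero : Tendsto (deriv u) (nhdsWithin 0 (Ioi 0)) atTop)
    (hinada_infty : Tendsto (deriv u) atTop (nhds 0))
    (I : ℝ → ℝ) (hI : ∀ y : ℝ, 0 < y → 0 < I y ∧ deriv u (I y) = y)
    (y : ℝ) (hy : 0 < y)
    (cstar : E → ℝ) (hcstar : cstar = fun e => I (y * ξ e))
    (hbudget_int : Integrable (fun e => ξ e * cstar e) μ)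
    (hutil_int : Integrable (fun e => u (cstar e)) μ)
    (w : ℝ) (hw : w = ∫ e, ξ e * cstar e ∂μ) :
    ∀ c : E → ℝ, Measurable c → (∀ e, 0 < c e) →
      Integrable (fun e => u (c e)) μ →
      (∫⁻ e, ENNReal.ofReal (ξ e * c e) ∂μ) ≤ ENNReal.ofReal w →
      (∫ e, u (c e) ∂μ ≤ ∫ e, u (cstar e) ∂μ) ∧
      ((∫ e, u (c e) ∂μ = ∫ e, u (cstar e) ∂μ) → c =ᵐ[μ] cstar) := by
  intro c hcm hcpos hcint hbudget
  have hcstar_pos : ∀ e, 0 < cstar e := fun e => by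
    rw [hcstar]
    exact (hI _ (mul_pos hy (hξpos e))).1
  have htangent : ∀ e, c e ≠ cstar e →
      u (c e) < u (cstar e) + y * ξ e * (c e - cstar e) := fun e hne => by
    have hderiv : deriv u (cstar e) = y * ξ e := by
      rw [hcstar]
      exact (hI _ (mul_pos hy (hξpos e))).2
    rw [← hderiv]
    exact hconc.lt_tangent_of_hasDerivAt (hcstar_pos e) (hcpos e) hne
      (hdiff _ (hcstar_pos e)).hasDerivAt
  have hcost_nonneg : ∀ e, 0 ≤ ξ e * c e := fun e => (mul_pos (hξpos e) (hcpos e)).le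
  have hcost_int : Integrable (fun e => ξ e * c e) μ :=
    (lintegral_ofReal_ne_top_iff_integrable (hξm.mul hcm).aestronglyMeasurable
      (.of_forall hcost_nonneg)).1 (ne_top_of_le_ne_top ENNReal.ofReal_ne_top hbudget)
  have hw_nonneg : 0 ≤ w := by
    rw [hw]
    exact integral_nonneg fun e => (mul_pos (hξpos e) (hcstar_pos e)).le
  have hcost_le : ∫ e, ξ e * c e ∂μ ≤ w := by
    rw [← ofReal_integral_eq_lintegral_ofReal hcost_int (.of_forall hcost_nonneg)] at hbudget
    exact (ENNReal.ofReal_le_ofReal_iff hw_nonneg).1 hbudget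
  let gap : E → ℝ := fun e =>
    (u (cstar e) - u (c e)) + y * (ξ e * c e - ξ e * cstar e)
  have hgap_nonneg : ∀ e, 0 ≤ gap e := fun e => by
    by_cases hne : c e = cstar e
    · simp [gap, hne]
    · have := htangent e hne
      simp only [gap]
      linarith
  have hgap_int : Integrable gap μ :=
    (hutil_int.sub hcint).add ((hcost_int.sub hbudget_int).const_mul y)
  have hgap_integral : ∫ e, gap e ∂μ =
      (∫ e, u (cstar e) ∂μ - ∫ e, u (c e) ∂μ) + y * (∫ e, ξ e * c e ∂μ - w) := by
    rw [hw, ← integral_sub hutil_int hcint, ← integral_sub hcost_int hbudget_int,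
      ← integral_const_mul]
    exact integral_add (hutil_int.sub hcint) ((hcost_int.sub hbudget_int).const_mul y)
  have hgap_integral_nonneg : 0 ≤ ∫ e, gap e ∂μ := integral_nonneg hgap_nonneg
  have hcost_term : y * (∫ e, ξ e * c e ∂μ - w) ≤ 0 :=
    mul_nonpos_of_nonneg_of_nonpos hy.le (sub_nonpos.2 hcost_le)
  refine ⟨by linarith, fun heq => ?_⟩
  have hgap_zero : gap =ᵐ[μ] 0 :=
    (integral_eq_zero_iff_of_nonneg hgap_nonneg hgap_int).1 (by linarith)
  filter_upwards [hgap_zero] with e he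
  by_contra hne
  have := htangent e hne
  simp only [gap, Pi.zero_apply] at he
  linarith
end
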